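/- For every ε > 0 and every integer n > exp(exp(14/(√(1+28ε) - 1))), the number of divisors satisfies τ(n) < n^{(log 2 + ε)/log(log n)}. -/

import Mathlib

open Finset

lemma sum_le_sum_of_forall_ne_zero_mem {ι : Type*} {S T : Finset ι} {f : ι → ℝ}
    (hf : ∀ i, 0 ≤ f i) (h : ∀ i ∈ S, f i ≠ 0 → i ∈ T) : ∑ i ∈ S, f i ≤ ∑ i ∈ T, f i := by
  classical
  rw [← sum_filter_ne_zero S]
  refine sum_le_sum_of_subset_of_nonneg (fun i hi ↦ ?_) fun i _ _ ↦ hf i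
  rw [mem_filter] at hi
  exact h i hi.1 hi.2

/-- The sum of `log (w / p)` over the primes `p ≤ w`. -/
noncomputable def primeLogSum (w : ℝ) : ℝ :=
  ∑ p ∈ Nat.primesLE ⌊w⌋₊, (Real.log w - Real.log p)

lemma primeLogSum_eq (w : ℝ) :
    primeLogSum w = Nat.primeCounting ⌊w⌋₊ * Real.log w - Chebyshev.theta w := by
  rw [primeLogSum, sum_sub_distrib, sum_const, Nat.primesLE_card_eq_primeCounting,
    Chebyshev.theta_eq_sum_primesLE, nsmul_eq_mul]

lemma sum_max_log_sub_log_le_primeLogSum {S : Finset ℕ} (hS : ∀ p ∈ S, p.Prime) {w : ℝ}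
    (hw : 0 < w) : ∑ p ∈ S, max 0 (Real.log w - Real.log p) ≤ primeLogSum w := by
  have key : ∀ p ∈ Nat.primesLE ⌊w⌋₊, 0 ≤ Real.log w - Real.log p := fun p hp ↦ by
    have h := Nat.mem_primesLE.1 hp
    have : (p : ℝ) ≤ w := (Nat.le_floor_iff hw.le).1 h.1
    have := Real.log_le_log (by exact_mod_cast h.2.pos) this
    linarith
  have heq : primeLogSum w = ∑ p ∈ Nat.primesLE ⌊w⌋₊, max 0 (Real.log w - Real.log p) :=
    sum_congr rfl fun p hp ↦ (max_eq_right (key p hp)).symm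
  rw [heq]
  refine sum_le_sum_of_forall_ne_zero_mem (fun _ ↦ le_max_left _ _) fun p hp hne ↦ Nat.mem_primesLE.2 ⟨?_, hS p hp⟩
  rw [Nat.le_floor_iff hw.le]
  by_contra! hlt
  exact hne (max_eq_left (by linarith [Real.log_le_log hw hlt.le]))

lemma log_succ_eq_sum (a : ℕ) :
    Real.log (a + 1) = ∑ j ∈ Icc 1 a, Real.log (1 + 1 / (j : ℝ)) := by
  induction a with
  | zero => simp
  | succ a ih =>
    rw [sum_Icc_succ_top (by omega), ← ih, ← Real.log_mul (by positivity) (by positivity)]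
    congr 1
    push_cast
    field_simp

lemma log_one_add_inv_le {A j : ℕ} {c : ℝ} (hA : 1 ≤ (A + 1) * c) (hj : A < j) :
    Real.log (1 + 1 / (j : ℝ)) ≤ c := by
  have hj' : (A + 1 : ℝ) ≤ j := by exact_mod_cast hj
  have hj0 : (0 : ℝ) < j := by
    have : (0 : ℝ) ≤ A := A.cast_nonneg
    linarith
  have hc : 0 < c := by
    by_contra! h
    nlinarith [(A.cast_nonneg : (0 : ℝ) ≤ A)]
  have h1 : 1 / (j : ℝ) ≤ c := by
    rw [div_le_iff₀ hj0]
    nlinarith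
  have := Real.log_le_sub_one_of_pos (show 0 < 1 + 1 / (j : ℝ) by positivity)
  linarith

lemma log_succ_sub_le {δ : ℝ} (hδ : 0 < δ) {A : ℕ} (hA : 1 ≤ (A + 1) * (δ * Real.log 2))
    {p : ℕ} (hp : p.Prime) (a : ℕ) :
    Real.log (a + 1) - δ * (a * Real.log p) ≤
      ∑ j ∈ Icc 1 A, max 0 (Real.log (1 + 1 / (j : ℝ)) - δ * Real.log p) := by
  have h2 : Real.log 2 ≤ Real.log p :=
    Real.log_le_log (by norm_num) (by exact_mod_cast hp.two_le)
  calc Real.log (a + 1) - δ * (a * Real.log p)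
      = ∑ j ∈ Icc 1 a, (Real.log (1 + 1 / (j : ℝ)) - δ * Real.log p) := by
        rw [sum_sub_distrib, ← log_succ_eq_sum]
        simp
        ring
    _ ≤ ∑ j ∈ Icc 1 a, max 0 (Real.log (1 + 1 / (j : ℝ)) - δ * Real.log p) :=
        sum_le_sum fun j _ ↦ le_max_right _ _
    _ ≤ _ := by
        refine sum_le_sum_of_forall_ne_zero_mem (fun _ ↦ le_max_left _ _) fun j hj hne ↦ ?_
        rw [mem_Icc] at hj ⊢
        refine ⟨hj.1, ?_⟩
        by_contra! hlt
        apply hne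
        have h3 := log_one_add_inv_le hA hlt
        have h4 := mul_le_mul_of_nonneg_left h2 hδ.le
        exact max_eq_left (by linarith)

lemma log_card_divisors {n : ℕ} (hn : n ≠ 0) :
    Real.log n.divisors.card = ∑ p ∈ n.primeFactors, Real.log (n.factorization p + 1) := by
  rw [Nat.card_divisors hn]
  push_cast
  exact Real.log_prod fun p _ ↦ by positivity

lemma log_eq_sum_factorization {n : ℕ} (hn : n ≠ 0) :
    Real.log n = ∑ p ∈ n.primeFactors, n.factorization p * Real.log p := by
  conv_lhs => rw [← Nat.prod_factorization_pow_eq_self hn, Finsupp.prod]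
  push_cast
  rw [Real.log_prod, Nat.support_factorization]
  · exact sum_congr rfl fun p _ ↦ Real.log_pow _ _
  · intro p hp
    have := (Nat.prime_of_mem_primeFactors hp).pos
    positivity

lemma log_card_divisors_le {δ : ℝ} (hδ : 0 < δ) {A : ℕ}
    (hA : 1 ≤ (A + 1) * (δ * Real.log 2)) {n : ℕ} (hn : n ≠ 0) :
    Real.log n.divisors.card ≤ δ * (Real.log n +
      ∑ j ∈ Icc 1 A, primeLogSum (Real.exp (Real.log (1 + 1 / (j : ℝ)) / δ))) := by
  have h1 : Real.log n.divisors.card - δ * Real.log n ≤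
      ∑ p ∈ n.primeFactors,
        ∑ j ∈ Icc 1 A, max 0 (Real.log (1 + 1 / (j : ℝ)) - δ * Real.log p) := by
    rw [log_card_divisors hn, log_eq_sum_factorization hn, mul_sum, ← sum_sub_distrib]
    exact sum_le_sum fun p hp ↦ log_succ_sub_le hδ hA (Nat.prime_of_mem_primeFactors hp) _
  have h2 : ∀ j ∈ Icc 1 A,
      ∑ p ∈ n.primeFactors, max 0 (Real.log (1 + 1 / (j : ℝ)) - δ * Real.log p) ≤
        δ * primeLogSum (Real.exp (Real.log (1 + 1 / (j : ℝ)) / δ)) := fun j _ ↦ by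
    refine le_trans (le_of_eq ?_) (mul_le_mul_of_nonneg_left
      (sum_max_log_sub_log_le_primeLogSum (S := n.primeFactors) (fun p ↦ Nat.prime_of_mem_primeFactors)
        (Real.exp_pos _)) hδ.le)
    rw [mul_sum]
    refine sum_congr rfl fun p _ ↦ ?_
    rw [mul_max_of_nonneg _ _ hδ.le, mul_zero, Real.log_exp]
    congr 1
    field_simp
  rw [sum_comm] at h1
  have h3 := sum_le_sum h2
  rw [← mul_sum] at h3
  linarith

lemma primeCounting_succ (M : ℕ) :
    Nat.primeCounting (M + 1) =
      if (M + 1).Prime then Nat.primeCounting M + 1 else Nat.primeCounting M := by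
  rw [← Nat.primesLE_card_eq_primeCounting, ← Nat.primesLE_card_eq_primeCounting,
    Nat.primesLE_succ]
  split_ifs
  · exact card_insert_of_notMem (Nat.notMem_primesLE M)
  · rfl

lemma two_mul_primeCounting_add_two_le {M : ℕ} (hM : 9 ≤ M) :
    2 * Nat.primeCounting M + 2 ≤ M + M % 2 := by
  induction M, hM using Nat.le_induction with
  | base => decide
  | succ M hM ih =>
    rw [primeCounting_succ]
    split_ifs with hp
    · have := hp.eq_two_or_odd
      omega
    · omega

lemma succ_mul_log_two_mul_le {k : ℕ} {q : ℝ} (hq : 2 * ((k : ℝ) + 1) ≤ q) :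
    ((k : ℝ) + 1) * Real.log (2 * ((k : ℝ) + 1)) - (k + 1) ≤
      k * Real.log (2 * k) - k + Real.log q := by
  have h1 := Real.log_le_log (by positivity) hq
  rcases Nat.eq_zero_or_pos k with rfl | hk
  · norm_num at h1 ⊢
    linarith
  · have hk' : (0 : ℝ) < k := by exact_mod_cast hk
    have h2 := Real.log_le_sub_one_of_pos (show 0 < (2 * ((k : ℝ) + 1)) / (2 * k) by positivity)
    rw [Real.log_div (by positivity) (by positivity)] at h2
    have h3 := mul_le_mul_of_nonneg_left h2 hk'.le
    have h4 : (k : ℝ) * ((2 * ((k : ℝ) + 1)) / (2 * k) - 1) = 1 := by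
      field_simp
      ring
    linarith

lemma mul_log_two_mul_sub_le {k m : ℕ} (hk : 0 < k) (h : (20 * k) ^ k ≤ m * 27 ^ k) :
    (k : ℝ) * Real.log (2 * k) - k ≤ Real.log m := by
  have hm : 0 < m := by
    by_contra! h0
    have : 0 < (20 * k) ^ k := by positivity
    simp_all
  have h1 : ((20 * k) ^ k : ℝ) ≤ m * 27 ^ k := by exact_mod_cast h
  have h2 : (2 * k : ℝ) ^ k ≤ m * Real.exp 1 ^ k := by
    calc (2 * k : ℝ) ^ k = (20 * k) ^ k / 10 ^ k := by
          rw [← div_pow]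
          congr 1
          ring
      _ ≤ m * 27 ^ k / 10 ^ k := by gcongr
      _ = m * (2.7 : ℝ) ^ k := by
          rw [mul_div_assoc, ← div_pow]
          norm_num
      _ ≤ _ := by
          gcongr
          linarith [Real.exp_one_gt_d9]
  have hk' : (0 : ℝ) < k := by exact_mod_cast hk
  have hm' : (0 : ℝ) < m := by exact_mod_cast hm
  have h3 := Real.log_le_log (by positivity) h2
  rw [Real.log_mul (by positivity) (by positivity), Real.log_pow, Real.log_pow,
    Real.log_exp] at h3
  linarith

lemma primeCounting_mul_log_sub_le_theta (N : ℕ) :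
    Nat.primeCounting N * Real.log (2 * Nat.primeCounting N) - Nat.primeCounting N ≤
      Chebyshev.theta N := by
  rcases lt_or_ge N 2 with h | h
  · have : Nat.primeCounting N = 0 := by interval_cases N <;> decide
    rw [this]
    simpa using Chebyshev.theta_nonneg N
  rcases lt_or_ge N 9 with h' | h'
  · rw [Chebyshev.theta_eq_log_primorial, Nat.floor_natCast]
    apply mul_log_two_mul_sub_le
    · interval_cases N <;> decide +kernel
    · interval_cases N <;> decide +kernel
  · clear h
    induction N, h' using Nat.le_induction with
    | base =>
      rw [Chebyshev.theta_eq_log_primorial, Nat.floor_natCast]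
      exact mul_log_two_mul_sub_le (by decide +kernel) (by decide +kernel)
    | succ M hM ih =>
      have h2 := two_mul_primeCounting_add_two_le hM
      have h3 : Chebyshev.theta ((M + 1 : ℕ) : ℝ) =
          if (M + 1).Prime then Real.log ((M + 1 : ℕ) : ℝ) + Chebyshev.theta M
          else Chebyshev.theta M := by
        rw [Chebyshev.theta_eq_sum_primesLE_log, Chebyshev.theta_eq_sum_primesLE_log,
          Nat.primesLE_succ]
        split_ifs
        · exact sum_insert (Nat.notMem_primesLE M)
        · rfl
      rw [h3, primeCounting_succ]
      split_ifs with hp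
      · have h4 : 2 * (Nat.primeCounting M + 1) ≤ M + 1 := by omega
        have h5 := succ_mul_log_two_mul_le (k := Nat.primeCounting M) (q := ((M + 1 : ℕ) : ℝ))
          (by exact_mod_cast h4)
        push_cast at h5 ⊢
        linarith
      · exact ih

lemma primeLogSum_le_half {w : ℝ} (hw : 0 < w) : primeLogSum w ≤ w / 2 := by
  rw [primeLogSum_eq]
  have h := primeCounting_mul_log_sub_le_theta ⌊w⌋₊
  rw [← Chebyshev.theta_eq_theta_coe_floor] at h
  have hk : (0 : ℝ) ≤ Nat.primeCounting ⌊w⌋₊ := Nat.cast_nonneg _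
  generalize (Nat.primeCounting ⌊w⌋₊ : ℝ) = k at h hk ⊢
  rcases hk.eq_or_lt with rfl | h0
  · simp at h ⊢
    linarith
  · have h1 := Real.log_le_sub_one_of_pos (show 0 < w / (2 * k) by positivity)
    rw [Real.log_div hw.ne' (by positivity)] at h1
    have h2 := mul_le_mul_of_nonneg_left h1 h0.le
    have h3 : k * (w / (2 * k) - 1) = w / 2 - k := by
      field_simp
    linarith

lemma primeLogSum_two_pow_le {k a b : ℕ} (h : 2 ^ a ≤ primorial (2 ^ k))
    (hb : Nat.primeCounting (2 ^ k) * k ≤ a + b) :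
    primeLogSum (2 ^ k) ≤ b * Real.log 2 := by
  have hfl : ⌊(2 : ℝ) ^ k⌋₊ = 2 ^ k := by
    exact_mod_cast Nat.floor_natCast (R := ℝ) (2 ^ k)
  rw [primeLogSum_eq, Chebyshev.theta_eq_log_primorial, hfl, Real.log_pow]
  have h1 : (a : ℝ) * Real.log 2 ≤ Real.log (primorial (2 ^ k)) := by
    rw [← Real.log_pow]
    exact Real.log_le_log (by positivity) (by exact_mod_cast h)
  have h2 : ((Nat.primeCounting (2 ^ k) * k : ℕ) : ℝ) ≤ (a + b : ℕ) := by exact_mod_cast hb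
  push_cast at h2
  have h3 := mul_le_mul_of_nonneg_right h2 (Real.log_nonneg one_le_two)
  linarith

lemma primeLogSum_512_le : primeLogSum 512 ≤ 173 * Real.log 2 := by
  have := primeLogSum_two_pow_le (k := 9) (a := 700) (b := 173)
    (by decide +kernel) (by decide +kernel)
  norm_num at this ⊢
  exact this

lemma primeLogSum_64_le : primeLogSum 64 ≤ 32 * Real.log 2 := by
  have := primeLogSum_two_pow_le (k := 6) (a := 76) (b := 32)
    (by decide +kernel) (by decide +kernel)
  norm_num at this ⊢
  exact this

lemma primeLogSum_eq_integral {w : ℝ} (hw : 2 ≤ w) :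
    primeLogSum w =
      Real.log w * ∫ t in 2..w, Chebyshev.theta t / (t * Real.log t ^ 2) := by
  rw [primeLogSum_eq, Chebyshev.primeCounting_eq_theta_div_log_add_integral hw]
  have : Real.log w ≠ 0 := (Real.log_pos (by linarith)).ne'
  field_simp
  ring

lemma hasDerivAt_div_log_sq_mul {t : ℝ} (ht : 1 < t) :
    HasDerivAt (fun t ↦ t / Real.log t ^ 2 * (1 + 4 / Real.log t))
      (1 / Real.log t ^ 2 + (2 * Real.log t - 12) / Real.log t ^ 4) t := by
  have h0 : t ≠ 0 := by linarith
  have hl : Real.log t ≠ 0 := (Real.log_pos ht).ne'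
  have hd := Real.hasDerivAt_log h0
  convert! (((hasDerivAt_id t).div (hd.pow 2) (pow_ne_zero 2 hl)).mul
    (((hasDerivAt_const t (4 : ℝ)).div hd hl).const_add 1)) using 1
  simp
  field_simp
  ring

lemma log_512 : Real.log 512 = 9 * Real.log 2 := by
  rw [show (512 : ℝ) = 2 ^ 9 by norm_num, Real.log_pow]
  norm_num

lemma log_four : Real.log 4 = 2 * Real.log 2 := by
  rw [show (4 : ℝ) = 2 ^ 2 by norm_num, Real.log_pow]
  norm_num

lemma integral_one_div_log_sq_le {a b : ℝ} (ha : 512 ≤ a) (hab : a ≤ b) :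
    ∫ t in a..b, 1 / Real.log t ^ 2 ≤
      b / Real.log b ^ 2 * (1 + 4 / Real.log b) - a / Real.log a ^ 2 * (1 + 4 / Real.log a) := by
  have hder : ∀ t ∈ Set.uIcc a b, HasDerivAt (fun t ↦ t / Real.log t ^ 2 * (1 + 4 / Real.log t))
      (1 / Real.log t ^ 2 + (2 * Real.log t - 12) / Real.log t ^ 4) t := fun t ht ↦ by
    rw [Set.uIcc_of_le hab] at ht
    exact hasDerivAt_div_log_sq_mul (by linarith [ht.1])
  have hcont : ContinuousOn
      (fun t ↦ 1 / Real.log t ^ 2 + (2 * Real.log t - 12) / Real.log t ^ 4) (Set.uIcc a b) := by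
    rw [Set.uIcc_of_le hab]
    intro t ht
    have h0 : t ≠ 0 := by linarith [ht.1]
    have hl : Real.log t ≠ 0 := (Real.log_pos (by linarith [ht.1])).ne'
    have h2 : Real.log t ^ 2 ≠ 0 := pow_ne_zero _ hl
    have h4 : Real.log t ^ 4 ≠ 0 := pow_ne_zero _ hl
    exact ContinuousAt.continuousWithinAt (by fun_prop (disch := assumption))
  rw [← intervalIntegral.integral_eq_sub_of_hasDerivAt hder hcont.intervalIntegrable]
  refine intervalIntegral.integral_mono_on hab
    (Chebyshev.intervalIntegrable_one_div_log_sq (by linarith) (by linarith))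
    hcont.intervalIntegrable fun t ht ↦ ?_
  have h6 : 6 ≤ Real.log t := by
    have h1 : Real.log 512 ≤ Real.log t := Real.log_le_log (by norm_num) (ha.trans ht.1)
    have h2 := log_512
    linarith [Real.log_two_gt_d9]
  have : 0 ≤ (2 * Real.log t - 12) / Real.log t ^ 4 :=
    div_nonneg (by linarith) (by positivity)
  linarith

lemma primeLogSum_le {w : ℝ} (hw : 512 ≤ w) :
    primeLogSum w ≤ Real.log 4 * (w / Real.log w * (1 + 4 / Real.log w)) := by
  have hint : ∀ {a b : ℝ}, 2 ≤ a → a ≤ b →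
      IntervalIntegrable (fun t ↦ Chebyshev.theta t / (t * Real.log t ^ 2))
        MeasureTheory.volume a b := fun {a b} ha hab ↦ by
    rw [intervalIntegrable_iff_integrableOn_Icc_of_le hab]
    exact (Chebyshev.integrableOn_theta_div_id_mul_log_sq b).mono_set
      (Set.Icc_subset_Icc_left ha)
  have hbase : ∫ t in (2 : ℝ)..512, Chebyshev.theta t / (t * Real.log t ^ 2) ≤
      Real.log 4 * (512 / Real.log 512 ^ 2 * (1 + 4 / Real.log 512)) := by
    have h1 := primeLogSum_512_le
    rw [primeLogSum_eq_integral (by norm_num)] at h1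
    have h2 := log_512
    have h3 := log_four
    have hl := Real.log_two_gt_d9
    have hl' := Real.log_two_lt_d9
    rw [h2] at h1 ⊢
    rw [h3]
    have h4 : ∫ t in (2 : ℝ)..512, Chebyshev.theta t / (t * Real.log t ^ 2) ≤ 173 / 9 := by
      by_contra! h
      have := mul_lt_mul_of_pos_left h (show 0 < 9 * Real.log 2 by linarith)
      linarith
    refine h4.trans ?_
    rw [show 2 * Real.log 2 * (512 / (9 * Real.log 2) ^ 2 * (1 + 4 / (9 * Real.log 2))) =
      1024 * (9 * Real.log 2 + 4) / (729 * Real.log 2 ^ 2) by field_simp; ring,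
      div_le_div_iff₀ (by norm_num) (by positivity)]
    nlinarith
  have hmono : ∫ t in (512 : ℝ)..w, Chebyshev.theta t / (t * Real.log t ^ 2) ≤
      Real.log 4 * ∫ t in (512 : ℝ)..w, 1 / Real.log t ^ 2 := by
    rw [← intervalIntegral.integral_const_mul]
    refine intervalIntegral.integral_mono_on hw (hint (by norm_num) hw)
      ((Chebyshev.intervalIntegrable_one_div_log_sq (by norm_num) (by linarith)).const_mul _)
      fun t ht ↦ ?_
    have ht0 : 0 < t := by linarith [ht.1]
    have hl : 0 < Real.log t := Real.log_pos (by linarith [ht.1])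
    rw [mul_one_div, div_le_div_iff₀ (by positivity) (by positivity)]
    have := mul_le_mul_of_nonneg_right (Chebyshev.theta_le_log4_mul_x ht0.le)
      (sq_nonneg (Real.log t))
    linarith
  have hl4 : 0 ≤ Real.log 4 := Real.log_nonneg (by norm_num)
  have hlw : 0 < Real.log w := Real.log_pos (by linarith)
  have h := mul_le_mul_of_nonneg_left (integral_one_div_log_sq_le le_rfl hw) hl4
  rw [primeLogSum_eq_integral (by linarith),
    ← intervalIntegral.integral_add_adjacent_intervals (hint le_rfl (by norm_num))
      (hint (by norm_num) hw)]
  calc _ ≤ Real.log w *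
        (Real.log 4 * (w / Real.log w ^ 2 * (1 + 4 / Real.log w))) := by
        gcongr
        linarith
    _ = _ := by field_simp

lemma log_card_divisors_le_add_half_sum {δ : ℝ} (hδ : 0 < δ) {A : ℕ} (hA1 : 1 ≤ A)
    (hA : 1 ≤ (A + 1) * (δ * Real.log 2)) {n : ℕ} (hn : n ≠ 0) :
    Real.log n.divisors.card ≤ δ * (Real.log n + primeLogSum (Real.exp (Real.log 2 / δ)) +
      (∑ j ∈ Icc 2 A, Real.exp (Real.log (1 + 1 / (j : ℝ)) / δ)) / 2) := by
  refine (log_card_divisors_le hδ hA hn).trans ?_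
  rw [← add_sum_Ioc_eq_sum_Icc hA1, add_assoc]
  have h1 : (1 : ℝ) + 1 / ((1 : ℕ) : ℝ) = 2 := by norm_num
  have h2 : Ioc 1 A = Icc 2 A := rfl
  rw [h1, h2, sum_div]
  gcongr
  exact primeLogSum_le_half (Real.exp_pos _)

lemma log_card_divisors_le_natCast {k A : ℕ} (hk : 0 < k) (hA1 : 1 ≤ A)
    (hA : k ≤ (A + 1) * Real.log 2) {n : ℕ} (hn : n ≠ 0) :
    Real.log n.divisors.card ≤ (Real.log n + primeLogSum (2 ^ k) +
      (∑ j ∈ Icc 2 A, (1 + 1 / (j : ℝ)) ^ k) / 2) / k := by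
  have hk' : (0 : ℝ) < k := by exact_mod_cast hk
  have hexp : ∀ y : ℝ, 0 < y → Real.exp (Real.log y / (k : ℝ)⁻¹) = y ^ k := fun y hy ↦ by
    rw [div_inv_eq_mul, mul_comm, Real.exp_nat_mul, Real.exp_log hy]
  have h := log_card_divisors_le_add_half_sum (inv_pos.2 hk') hA1
    (by rw [mul_left_comm, ← div_eq_inv_mul, le_div_iff₀ hk']; linarith) hn
  rw [hexp 2 (by norm_num), sum_congr rfl fun (j : ℕ) _ ↦ hexp (1 + 1 / (j : ℝ)) (by positivity),
    ← div_eq_inv_mul] at h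
  exact h

lemma log_card_divisors_le_div_six {n : ℕ} (hn : n ≠ 0) :
    Real.log n.divisors.card ≤ Real.log n / 6 + 6.4 := by
  have h := log_card_divisors_le_natCast (k := 6) (A := 8) (by norm_num) (by norm_num)
    (by norm_num; linarith [Real.log_two_gt_d9]) hn
  have h64 := primeLogSum_64_le
  norm_num [sum_Icc_succ_top] at h ⊢
  linarith [Real.log_two_lt_d9]

lemma log_card_divisors_le_div_nine {n : ℕ} (hn : n ≠ 0) :
    Real.log n.divisors.card ≤ Real.log n / 9 + 18 := by
  have h := log_card_divisors_le_natCast (k := 9) (A := 12) (by norm_num) (by norm_num)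
    (by norm_num; linarith [Real.log_two_gt_d9]) hn
  have h512 := primeLogSum_512_le
  norm_num [sum_Icc_succ_top] at h ⊢
  linarith [Real.log_two_lt_d9]

lemma pow_le_exp_div_four (m : ℕ) : (1.284 : ℝ) ^ m ≤ Real.exp (m / 4) := by
  have h : (1.284 : ℝ) ≤ Real.exp (1 / 4) := by
    have := Real.sum_le_exp_of_nonneg (x := 1 / 4) (by norm_num) 5
    norm_num [sum_range_succ, Nat.factorial] at this
    linarith
  calc (1.284 : ℝ) ^ m ≤ Real.exp (1 / 4) ^ m := by gcongr
    _ = _ := by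
      rw [← Real.exp_nat_mul]
      congr 1
      ring

lemma exp_mul_add_le_of_quarter_step {x d F : ℝ} {m : ℕ} (hx : 0 < x) (hF : 0 ≤ F)
    (hm : (m : ℝ) / 4 ≤ x) (hm' : x ≤ ((m : ℝ) + 1) / 4)
    (h : d + F / 1.284 ^ m ≤ 0.6931 / (((m : ℝ) + 1) / 4) + 1 / (((m : ℝ) + 1) / 4) ^ 2 +
      7 / (((m : ℝ) + 1) / 4) ^ 3) :
    Real.exp x * d + F ≤ Real.exp x / x * (Real.log 2 + 1 / x + 7 / x ^ 2) := by
  have h1 : (1.284 : ℝ) ^ m ≤ Real.exp x :=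
    (pow_le_exp_div_four m).trans (Real.exp_le_exp.2 hm)
  have h2 : F ≤ Real.exp x * (F / 1.284 ^ m) := by
    rw [mul_div_assoc', le_div_iff₀ (by positivity), mul_comm]
    gcongr
  have h3 : 0.6931 / (((m : ℝ) + 1) / 4) + 1 / (((m : ℝ) + 1) / 4) ^ 2 +
      7 / (((m : ℝ) + 1) / 4) ^ 3 ≤ Real.log 2 / x + 1 / x ^ 2 + 7 / x ^ 3 := by
    gcongr
    linarith [Real.log_two_gt_d9]
  have h4 := mul_le_mul_of_nonneg_left (h.trans h3) (Real.exp_pos x).le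
  have h5 : Real.exp x * (Real.log 2 / x + 1 / x ^ 2 + 7 / x ^ 3) =
      Real.exp x / x * (Real.log 2 + 1 / x + 7 / x ^ 2) := by
    field_simp
  linarith

lemma pow_le_mul_exp_sub {x c a : ℝ} {m : ℕ} (ha : 0 < a) (hx : a ≤ x) (hc : m ≤ c * a) :
    x ^ m ≤ a ^ m * Real.exp (c * (x - a)) := by
  have h1 : x / a ≤ Real.exp (x / a - 1) := by linarith [Real.add_one_le_exp (x / a - 1)]
  have h2 : 0 ≤ x / a - 1 := by
    rw [sub_nonneg, le_div_iff₀ ha]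
    linarith
  calc x ^ m = a ^ m * (x / a) ^ m := by
        rw [← mul_pow]
        congr 1
        field_simp
    _ ≤ a ^ m * Real.exp (x / a - 1) ^ m := by
        have : 0 ≤ x / a := by linarith
        gcongr
    _ = a ^ m * Real.exp (m * (x / a - 1)) := by rw [Real.exp_nat_mul]
    _ ≤ a ^ m * Real.exp (c * a * (x / a - 1)) := by gcongr
    _ = _ := by
        congr 2
        field_simp

lemma log_le_mul_log_two_of_pow_le {y c : ℝ} {a b : ℕ} (hy : 0 < y) (hb : 0 < b)
    (h : y ^ b ≤ 2 ^ a) (hc : c = a / b) : Real.log y ≤ c * Real.log 2 := by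
  have h1 := Real.log_le_log (by positivity) h
  rw [Real.log_pow, Real.log_pow] at h1
  have hb' : (0 : ℝ) < b := by exact_mod_cast hb
  rw [hc, div_mul_eq_mul_div, le_div_iff₀ hb']
  linarith

lemma sum_exp_log_one_add_le {δ x : ℝ} (hδ : 0 < δ) (hx : Real.log 2 / δ = x) (A : ℕ) :
    ∑ j ∈ Icc 2 A, Real.exp (Real.log (1 + 1 / (j : ℝ)) / δ) ≤
      Real.exp (10 / 17 * x) + Real.exp (5 / 12 * x) + A * Real.exp (1 / 3 * x) := by
  have hexp : ∀ y c : ℝ, Real.log y ≤ c * Real.log 2 →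
      Real.exp (Real.log y / δ) ≤ Real.exp (c * x) := fun y c h ↦ by
    rw [← hx, mul_div_assoc']
    gcongr
  have hterm : ∀ j ∈ Icc 2 A, Real.exp (Real.log (1 + 1 / (j : ℝ)) / δ) ≤
      (if j = 2 then Real.exp (10 / 17 * x) else 0) +
        (if j = 3 then Real.exp (5 / 12 * x) else 0) + Real.exp (1 / 3 * x) := fun j hj ↦ by
    have hj2 := (mem_Icc.1 hj).1
    have hpos := Real.exp_pos (1 / 3 * x)
    by_cases h2 : j = 2
    · subst h2
      have := hexp (1 + 1 / (2 : ℕ)) (10 / 17)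
        (log_le_mul_log_two_of_pow_le (a := 10) (b := 17) (by positivity) (by norm_num)
          (by norm_num) (by norm_num))
      simp only [if_true, show (2 : ℕ) ≠ 3 by norm_num, if_false]
      linarith
    by_cases h3 : j = 3
    · subst h3
      have := hexp (1 + 1 / (3 : ℕ)) (5 / 12)
        (log_le_mul_log_two_of_pow_le (a := 5) (b := 12) (by positivity) (by norm_num)
          (by norm_num) (by norm_num))
      simp only [if_true, show (3 : ℕ) ≠ 2 by norm_num, if_false]
      linarith
    · have h4 : (4 : ℝ) ≤ j := by
        have : 4 ≤ j := by omega
        exact_mod_cast this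
      have h5 : 1 + 1 / (j : ℝ) ≤ 5 / 4 := by
        have : 1 / (j : ℝ) ≤ 1 / 4 := by gcongr
        linarith
      have h6 := Real.log_le_log (by positivity) h5
      have := hexp (1 + 1 / (j : ℝ)) (1 / 3) (h6.trans
        (log_le_mul_log_two_of_pow_le (a := 1) (b := 3) (by positivity) (by norm_num)
          (by norm_num) (by norm_num)))
      simpa [h2, h3] using this
  refine (sum_le_sum hterm).trans ?_
  rw [sum_add_distrib, sum_add_distrib, sum_ite_eq', sum_ite_eq', sum_const, nsmul_eq_mul]
  have hcard : (#(Icc 2 A) : ℝ) ≤ A := by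
    have : #(Icc 2 A) ≤ A := by
      rw [Nat.card_Icc]
      omega
    exact_mod_cast this
  gcongr
  all_goals
    split_ifs
    · exact le_rfl
    · positivity

lemma sq_mul_error_le {x : ℝ} (hx : 7.5 ≤ x) :
    x ^ 2 * (Real.exp (10 / 17 * x) + Real.exp (5 / 12 * x) +
      2.082 * x * Real.exp (1 / 3 * x)) ≤ 9.3 * Real.exp x := by
  have he := Real.exp_one_gt_d9
  have hlow : ∀ (N : ℕ) (s : ℝ), (2.718 : ℝ) ^ N * (1 + s) ≤ Real.exp (N + s) := fun N s ↦ by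
    rw [Real.exp_add, show (N : ℝ) = N * 1 by ring, Real.exp_nat_mul]
    rcases le_or_gt (1 + s) 0 with h | h
    · exact (mul_nonpos_of_nonneg_of_nonpos (by positivity) h).trans (by positivity)
    · gcongr
      · linarith
      · linarith [Real.add_one_le_exp s]
  have hbound : ∀ (m : ℕ) (c C : ℝ), m ≤ c * 7.5 → (7.5 : ℝ) ^ m ≤ C * Real.exp (c * 7.5) →
      x ^ m * Real.exp ((1 - c) * x) ≤ C * Real.exp x := fun m c C hc hC ↦ by
    have h1 := pow_le_mul_exp_sub (by norm_num) hx hc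
    calc x ^ m * Real.exp ((1 - c) * x)
        ≤ (C * Real.exp (c * 7.5)) * Real.exp (c * (x - 7.5)) * Real.exp ((1 - c) * x) := by
          gcongr
          refine h1.trans ?_
          gcongr
      _ = C * Real.exp x := by
          rw [mul_assoc C, mul_assoc C, ← Real.exp_add, ← Real.exp_add]
          ring_nf
  have h1 := hbound 2 (7 / 17) 2.6 (by norm_num) (by
    have := hlow 3 (3 / 34)
    norm_num at this ⊢
    linarith)
  have h2 := hbound 2 (7 / 12) 0.76 (by norm_num) (by
    have := hlow 4 (3 / 8)
    norm_num at this ⊢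
    linarith)
  have h3 := hbound 3 (2 / 3) 2.85 (by norm_num) (by
    have := hlow 5 0
    norm_num at this ⊢
    linarith)
  norm_num at h1 h2 h3 ⊢
  linarith [Real.exp_pos x]

lemma log_card_divisors_le_of_large {n : ℕ} (hn : n ≠ 0) {x : ℝ} (hx : 7.5 ≤ x)
    (hL : Real.log n = Real.exp x) :
    Real.log n.divisors.card ≤ Real.exp x / x * (Real.log 2 + 1 / x + 7 / x ^ 2) := by
  have hl := Real.log_two_gt_d9
  have hl' := Real.log_two_lt_d9
  have hx0 : 0 < x := by linarith
  have hl0 : 0 < Real.log 2 := by linarith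
  have hδ : 0 < Real.log 2 / x := by positivity
  have hlx : Real.log 2 / (Real.log 2 / x) = x := by field_simp
  have hfloor : x / Real.log 2 ^ 2 < (⌊x / Real.log 2 ^ 2⌋₊ : ℝ) + 1 := Nat.lt_floor_add_one _
  have hsq : 0.4804 ≤ Real.log 2 ^ 2 := by nlinarith
  have hA : (⌊x / Real.log 2 ^ 2⌋₊ : ℝ) ≤ 2.082 * x := by
    refine (Nat.floor_le (by positivity)).trans ?_
    rw [div_le_iff₀ (by positivity)]
    nlinarith
  have hA1 : 1 ≤ ⌊x / Real.log 2 ^ 2⌋₊ := by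
    rw [Nat.one_le_floor_iff, le_div_iff₀ (by positivity)]
    nlinarith
  have h := log_card_divisors_le_add_half_sum hδ hA1 (by
    rw [div_lt_iff₀ (by positivity)] at hfloor
    rw [show ∀ a : ℝ, a * (Real.log 2 / x * Real.log 2) = a * Real.log 2 ^ 2 / x by
      intro a; ring, le_div_iff₀ hx0]
    linarith) hn
  have hsum := sum_exp_log_one_add_le hδ hlx ⌊x / Real.log 2 ^ 2⌋₊
  have hL512 : 512 ≤ Real.exp x := by
    have h1 := pow_le_exp_div_four 30
    have h2 : Real.exp (15 / 2) ≤ Real.exp x := Real.exp_le_exp.2 (by linarith)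
    norm_num at h1
    linarith
  have hmain := primeLogSum_le hL512
  rw [Real.log_exp, log_four] at hmain
  rw [hlx, hL] at h
  have herr := sq_mul_error_le hx
  set R := Real.exp (10 / 17 * x) + Real.exp (5 / 12 * x) + 2.082 * x * Real.exp (1 / 3 * x)
  have hR : ∑ j ∈ Icc 2 ⌊x / Real.log 2 ^ 2⌋₊,
      Real.exp (Real.log (1 + 1 / (j : ℝ)) / (Real.log 2 / x)) ≤ R := by
    refine hsum.trans ?_
    have := mul_le_mul_of_nonneg_right hA (Real.exp_pos (1 / 3 * x)).le
    simp only [R]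
    linarith
  have hR' : R ≤ 9.3 * Real.exp x / x ^ 2 := by
    rw [le_div_iff₀ (by positivity)]
    linarith
  set E := Real.exp x
  have hE : 0 < E := Real.exp_pos x
  calc Real.log n.divisors.card
      ≤ Real.log 2 / x * (E + 2 * Real.log 2 * (E / x * (1 + 4 / x)) +
          9.3 * E / x ^ 2 / 2) := by
        refine h.trans ?_
        gcongr
        exact hR.trans hR'
    _ = E / x ^ 3 * (Real.log 2 * x ^ 2 + 2 * Real.log 2 ^ 2 * (x + 4) +
          4.65 * Real.log 2) := by
        field_simp
        ring
    _ ≤ E / x ^ 3 * (Real.log 2 * x ^ 2 + (x + 7)) := by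
        have h2 : Real.log 2 ^ 2 ≤ 0.4805 := by nlinarith
        exact mul_le_mul_of_nonneg_left (by nlinarith) (by positivity)
    _ = _ := by field_simp; ring

lemma log_card_divisors_le_of_small {n : ℕ} (hn : n ≠ 0) {x : ℝ} (hx0 : 0 < x) (hx : x ≤ 7.5)
    (hL : Real.log n = Real.exp x) :
    Real.log n.divisors.card ≤ Real.exp x / x * (Real.log 2 + 1 / x + 7 / x ^ 2) := by
  obtain ⟨m, hm, hm', hm30⟩ : ∃ m : ℕ, (m : ℝ) / 4 ≤ x ∧ x ≤ ((m : ℝ) + 1) / 4 ∧ m < 30 := by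
    rcases hx.lt_or_eq with hlt | rfl
    · have h1 := Nat.floor_le (show 0 ≤ 4 * x by linarith)
      have h2 := Nat.lt_floor_add_one (4 * x)
      refine ⟨⌊4 * x⌋₊, by linarith, by linarith, ?_⟩
      rw [Nat.floor_lt (by linarith)]
      norm_num
      linarith
    · exact ⟨29, by norm_num, by norm_num, by norm_num⟩
  rcases lt_or_ge m 22 with h | h
  · refine (log_card_divisors_le_div_six hn).trans ?_
    rw [hL, div_eq_mul_inv]
    refine exp_mul_add_le_of_quarter_step hx0 (by norm_num) hm hm' ?_
    clear hm hm' hm30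
    interval_cases m <;> norm_num
  · refine (log_card_divisors_le_div_nine hn).trans ?_
    rw [hL, div_eq_mul_inv]
    refine exp_mul_add_le_of_quarter_step hx0 (by norm_num) hm hm' ?_
    clear hm hm'
    interval_cases m <;> norm_num

theorem tau_eps_bound (ε : ℝ) (hε : 0 < ε) (n : ℕ)
    (hn : Real.exp (Real.exp (14 / (Real.sqrt (1 + 28 * ε) - 1))) < (n : ℝ)) :
    (n.divisors.card : ℝ) < (n : ℝ) ^ ((Real.log 2 + ε) / Real.log (Real.log n)) := by
  set s := Real.sqrt (1 + 28 * ε) with hs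
  have hs1 : 1 < s := by
    rw [hs, Real.lt_sqrt (by norm_num)]
    linarith
  have hs2 : s ^ 2 = 1 + 28 * ε := Real.sq_sqrt (by linarith)
  have hnpos : (0 : ℝ) < n := (Real.exp_pos _).trans hn
  have hn0 : n ≠ 0 := by
    rintro rfl
    simp at hnpos
  have hlog : Real.exp (14 / (s - 1)) < Real.log n := (Real.lt_log_iff_exp_lt hnpos).2 hn
  have hLpos : 0 < Real.log n := (Real.exp_pos _).trans hlog
  have hxlt : 14 / (s - 1) < Real.log (Real.log n) := (Real.lt_log_iff_exp_lt hLpos).2 hlog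
  have hL : Real.log n = Real.exp (Real.log (Real.log n)) := (Real.exp_log hLpos).symm
  set x := Real.log (Real.log n) with hx
  have hx0 : 0 < x := lt_trans (div_pos (by norm_num) (by linarith)) hxlt
  have hεx : 1 / x + 7 / x ^ 2 < ε := by
    have h1 : 14 / x < s - 1 := by
      rw [div_lt_iff₀ (by linarith)] at hxlt
      rw [div_lt_iff₀ hx0]
      linarith
    have h2 : 0 < 14 / x := by positivity
    have h3 : 1 / x + 7 / x ^ 2 = ((1 + 14 / x) ^ 2 - 1) / 28 := by
      field_simp
      ring
    rw [h3]
    nlinarith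
  have hle : Real.log n.divisors.card ≤ Real.exp x / x * (Real.log 2 + 1 / x + 7 / x ^ 2) := by
    rcases le_total x 7.5 with h | h
    · exact log_card_divisors_le_of_small hn0 hx0 h hL
    · exact log_card_divisors_le_of_large hn0 h hL
  have hcard : (0 : ℝ) < n.divisors.card := by
    exact_mod_cast Finset.card_pos.2 (Nat.nonempty_divisors.2 hn0)
  rw [Real.rpow_def_of_pos hnpos, ← Real.log_lt_iff_lt_exp hcard, hL]
  calc Real.log n.divisors.card
      ≤ Real.exp x / x * (Real.log 2 + 1 / x + 7 / x ^ 2) := hle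
    _ < Real.exp x / x * (Real.log 2 + ε) := by
        refine mul_lt_mul_of_pos_left ?_ (by positivity)
        linarith
    _ = Real.exp x * ((Real.log 2 + ε) / x) := by ring
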